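/- arXiv:2110.12064 — 5 statements merged into one kernel-verified Lean document; each statement's English description precedes it below -/
import Mathlib

section
/- Let M be a structural equation model (SEM) over a DAG G=(V,E) with finite discrete variables, observed variables N ⊆ V, control variables C ⊆ Λ_G (the observed roots of G), and strictly positive observational distribution P^M(N). Let (Y,X) ∈ E and c ∈ D_C be such that under the intervention do(C=c) the structural function of X does not depend on Y (equivalently, the DAG obtained from G by removing the edge (Y,X) is a causal graph for the intervened model). Then the context-specific independence relation X ⟂ Y | C=c, Pa_X\({Y}∪C) holds in P^M; that is, writing A = Pa_X\({Y}∪C), for all a ∈ D_A and all y1, y2 ∈ D_Y one has P^M(X | C=c, A=a, Y=y1) = P^M(X | C=c, A=a, Y=y2). -/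
open Finset

/-- A structural equation model (SEM) over the directed graph `E` on the finite
vertex type `V`, with finite discrete domains `D v`.  Each vertex `v` has a finite
noise domain `Fin (noiseCard v)` with distribution `noiseDist v` (the noises are
jointly independent, so the joint noise weight is the product of the marginals),
and a structural function `f v` that may only depend on the parents of `v`. -/
structure SEM (V : Type) [Fintype V] [DecidableEq V]
    (E : V → V → Prop) (D : V → Type)
    [∀ v, Fintype (D v)] [∀ v, DecidableEq (D v)] : Type where
  noiseCard : V → ℕ
  noisePos : ∀ v, 0 < noiseCard v
  noiseDist : ∀ v, Fin (noiseCard v) → ℝ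
  noiseDist_nonneg : ∀ v n, 0 ≤ noiseDist v n
  noiseDist_sum_one : ∀ v, ∑ n, noiseDist v n = 1
  f : ∀ v, (∀ u, D u) → Fin (noiseCard v) → D v
  f_parents : ∀ v (g g' : ∀ u, D u) n,
    (∀ u, E u v → g u = g' u) → f v g n = f v g' n

/-- The relation `E` has no directed cycles (so a finite graph is a DAG). -/
def Acyclic {V : Type} (E : V → V → Prop) : Prop :=
  ∀ v, ¬ Relation.TransGen E v v

/-- A vertex is a root if it has no parents. -/
def IsRoot {V : Type} (E : V → V → Prop) (v : V) : Prop := ∀ u, ¬ E u v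

namespace SEM

variable {V : Type} [Fintype V] [DecidableEq V] {E : V → V → Prop}
  {D : V → Type} [∀ v, Fintype (D v)] [∀ v, DecidableEq (D v)]

/-- The joint noise outcome space of a SEM. -/
abbrev Ω (M : SEM V E D) : Type := ∀ v, Fin (M.noiseCard v)

/-- The probability of a joint noise outcome (noises are jointly independent). -/
noncomputable def W (M : SEM V E D) (ω : M.Ω) : ℝ :=
  ∏ v, M.noiseDist v (ω v)

/-- `g` solves the structural equations under the intervention `do(T = t)`
(only the values of `t` on `T` are relevant): intervened variables are forced to
their assigned values and every other variable is generated by its equation. -/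
def IsSolution (M : SEM V E D) (T : Set V) (t : ∀ v, D v)
    (g : M.Ω → ∀ v, D v) : Prop :=
  ∀ ω v, (v ∈ T → g ω v = t v) ∧ (v ∉ T → g ω v = M.f v (g ω) (ω v))

/-- `g` solves the structural equations with no intervention. -/
def IsObsSolution (M : SEM V E D) (g : M.Ω → ∀ v, D v) : Prop :=
  ∀ ω v, g ω v = M.f v (g ω) (ω v)

/-- The probability of the event `A` under the solution map `g`. -/
noncomputable def prob (M : SEM V E D) (g : M.Ω → ∀ v, D v)
    (A : (∀ v, D v) → Prop) : ℝ :=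
  letI := Classical.decPred fun ω : M.Ω => A (g ω)
  ∑ ω ∈ Finset.univ.filter (fun ω : M.Ω => A (g ω)), M.W ω

/-- `X ⟂ Y | S` within the context `ctx`, for the distribution induced by the
solution map `g`: the standard cross-multiplied form of conditional independence
of two discrete variables given the variables in `S` (in the context `ctx`). -/
def CondIndepOn (M : SEM V E D) (g : M.Ω → ∀ v, D v)
    (X Y : V) (S : Set V) (ctx : (∀ v, D v) → Prop) : Prop :=
  ∀ (x : D X) (y : D Y) (s : ∀ v, D v),
    M.prob g (fun w => w X = x ∧ w Y = y ∧ (∀ v ∈ S, w v = s v) ∧ ctx w) *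
        M.prob g (fun w => (∀ v ∈ S, w v = s v) ∧ ctx w) =
      M.prob g (fun w => w X = x ∧ (∀ v ∈ S, w v = s v) ∧ ctx w) *
        M.prob g (fun w => w Y = y ∧ (∀ v ∈ S, w v = s v) ∧ ctx w)

end SEM

namespace SEM

variable {V : Type} [Fintype V] [DecidableEq V] {E : V → V → Prop}
  {D : V → Type} [∀ v, Fintype (D v)] [∀ v, DecidableEq (D v)]

open Classical in
theorem prob_eq_sum_ite (M : SEM V E D) (g : M.Ω → ∀ v, D v) (A : (∀ v, D v) → Prop) :
    M.prob g A = ∑ ω, M.W ω * (if A (g ω) then 1 else 0) := by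
  simp only [prob, Finset.sum_filter, mul_ite, mul_one, mul_zero]

theorem W_eq_mul_prod_ne (M : SEM V E D) (X : V) (ω : M.Ω) :
    M.W ω = M.noiseDist X (ω X) * ∏ v : {v // v ≠ X}, M.noiseDist v (ω v) :=
  Fintype.prod_eq_mul_prod_subtype_ne (fun v => M.noiseDist v (ω v)) X

/-- The noise of `X` is independent of every quantity not depending on it. -/
theorem sum_W_mul_mul (M : SEM V E D) (X : V) (φ : Fin (M.noiseCard X) → ℝ) (ψ : M.Ω → ℝ)
    (hψ : ∀ ω n, ψ (Function.update ω X n) = ψ ω) :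
    ∑ ω, M.W ω * (φ (ω X) * ψ ω) =
      (∑ n, M.noiseDist X n * φ n) * ∑ ω, M.W ω * ψ ω := by
  have key : ∀ φ : Fin (M.noiseCard X) → ℝ, ∑ ω, M.W ω * (φ (ω X) * ψ ω) =
      (∑ n, M.noiseDist X n * φ n) *
        ∑ η : ∀ v : {v // v ≠ X}, Fin (M.noiseCard v), (∏ v : {v // v ≠ X}, M.noiseDist v (η v)) *
          ψ ((Equiv.piSplitAt X fun v => Fin (M.noiseCard v)).symm (⟨0, M.noisePos X⟩, η)) := by
    intro φ
    rw [← (Equiv.piSplitAt X fun v => Fin (M.noiseCard v)).symm.sum_comp,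
      Fintype.sum_prod_type, Finset.sum_mul_sum]
    refine Finset.sum_congr rfl fun n _ => Finset.sum_congr rfl fun η _ => ?_
    have hψη : ψ ((Equiv.piSplitAt X fun v => Fin (M.noiseCard v)).symm (n, η)) =
        ψ ((Equiv.piSplitAt X fun v => Fin (M.noiseCard v)).symm (⟨0, M.noisePos X⟩, η)) := by
      rw [← hψ ((Equiv.piSplitAt X fun v => Fin (M.noiseCard v)).symm
        (⟨0, M.noisePos X⟩, η)) n]
      congr 1
      ext1 v
      by_cases hv : v = X
      · subst hv
        simp [Equiv.piSplitAt]
      · simp [Equiv.piSplitAt, hv]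
    have hprod : ∏ v : {v // v ≠ X}, M.noiseDist v
        ((Equiv.piSplitAt X fun v => Fin (M.noiseCard v)).symm (n, η) v) =
        ∏ v : {v // v ≠ X}, M.noiseDist v (η v) :=
      Finset.prod_congr rfl fun v _ => by simp [Equiv.piSplitAt, v.2]
    have hX : (Equiv.piSplitAt X fun v => Fin (M.noiseCard v)).symm (n, η) X = n := by
      simp [Equiv.piSplitAt]
    rw [W_eq_mul_prod_ne M X, hψη, hprod, hX]
    ring
  have hone := key fun _ => 1
  simp only [one_mul, mul_one, M.noiseDist_sum_one] at hone
  rw [key φ, hone]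

/-- The noise of `X` only affects `X` and its descendants. -/
theorem IsObsSolution.update_apply {M : SEM V E D} {g : M.Ω → ∀ v, D v}
    (hg : M.IsObsSolution g) (hacyc : Acyclic E) {X : V} (ω : M.Ω) (n : Fin (M.noiseCard X))
    {v : V} (hvX : v ≠ X) (hv : ¬ Relation.TransGen E X v) :
    g (Function.update ω X n) v = g ω v := by
  have hwf : WellFounded (Relation.TransGen E) := by
    have : Std.Irrefl (Relation.TransGen E) := ⟨hacyc⟩
    exact Finite.wellFounded_of_trans_of_irrefl _
  induction v using hwf.induction with
  | h v ih =>
    rw [hg, hg ω, Function.update_of_ne hvX]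
    refine M.f_parents _ _ _ _ fun u hu => ih u (.single hu) ?_ fun h => hv (h.tail hu)
    rintro rfl
    exact hv (.single hu)

/-- If the equation of `X` reads `h` on the event `B`, and `B` does not depend on the noise
of `X`, then `B` and `X = x` factorise. -/
theorem IsObsSolution.prob_eq_and {M : SEM V E D} {g : M.Ω → ∀ v, D v}
    (hg : M.IsObsSolution g) {X : V} (x : D X) (h : Fin (M.noiseCard X) → D X)
    (B : (∀ v, D v) → Prop) (hB : ∀ ω n, B (g (Function.update ω X n)) ↔ B (g ω))
    (hh : ∀ w n, B w → M.f X w n = h n) :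
    M.prob g (fun w => w X = x ∧ B w) =
      (∑ n, M.noiseDist X n * (if h n = x then 1 else 0)) * M.prob g B := by
  classical
  rw [prob_eq_sum_ite, prob_eq_sum_ite,
    ← M.sum_W_mul_mul X (fun n => if h n = x then 1 else 0) _ fun ω n => by simp only [hB]]
  refine Finset.sum_congr rfl fun ω _ => ?_
  by_cases hω : B (g ω)
  · have : g ω X = h (ω X) := (hg ω X).trans (hh _ _ hω)
    simp [hω, this]
  · simp [hω]

end SEM

/-- Lemma 2 of the paper.  If `(Y,X)` is an edge of the causal
DAG, `C ⊆ Λ_G` is a set of observed-root control variables, the observational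
distribution over the observed variables `N` is strictly positive, and under the
intervention `do(C = c)` the structural function of `X` does not depend on `Y`,
then the context-specific independence `X ⟂ Y | C = c, Pa_X \ ({Y} ∪ C)` holds
in the observational distribution `P^M`. -/
theorem csi_of_context_functional_independence
    {V : Type} [Fintype V] [DecidableEq V] {E : V → V → Prop}
    {D : V → Type} [∀ v, Fintype (D v)] [∀ v, DecidableEq (D v)]
    (M : SEM V E D) (hacyc : Acyclic E)
    (N C : Set V) (hCN : C ⊆ N) (hCroot : ∀ v ∈ C, IsRoot E v)
    (g₀ : M.Ω → ∀ v, D v) (hg₀ : M.IsObsSolution g₀)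
    (hpos : ∀ (a : ∀ v, D v), 0 < M.prob g₀ (fun w => ∀ v ∈ N, w v = a v))
    (X Y : V) (hYX : E Y X) (c : ∀ v, D v)
    (hf : ∀ (w w' : ∀ u, D u) (n : Fin (M.noiseCard X)),
      (∀ v ∈ C, w v = c v) → (∀ v ∈ C, w' v = c v) →
      (∀ u, u ≠ Y → w u = w' u) → M.f X w n = M.f X w' n) :
    M.CondIndepOn g₀ X Y ({u | E u X} \ ({Y} ∪ C))
      (fun w => ∀ v ∈ C, w v = c v) := by
  classical
  intro x y s
  have hval : ∀ w n, ((∀ v ∈ {u | E u X} \ ({Y} ∪ C), w v = s v) ∧ ∀ v ∈ C, w v = c v) →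
      M.f X w n = M.f X (fun v => if v ∈ C then c v else s v) n := by
    rintro w n ⟨hS, hC⟩
    rw [hf w (Function.update w Y (if Y ∈ C then c Y else s Y)) n hC ?_ ?_]
    · refine M.f_parents _ _ _ _ fun u hu => ?_
      by_cases huY : u = Y
      · subst huY
        simp
      · by_cases huC : u ∈ C
        · simp [huY, huC, hC u huC]
        · simp [huY, huC, hS u ⟨hu, by simp [huY, huC]⟩]
    · intro v hv
      by_cases hvY : v = Y
      · subst hvY
        simp [hv]
      · simp [hvY, hC v hv]
    · intro u hu
      simp [hu]
  have hpar : ∀ v, E v X → ∀ ω n, g₀ (Function.update ω X n) v = g₀ ω v := fun v hv ω n =>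
    hg₀.update_apply hacyc ω n (by rintro rfl; exact hacyc _ (.single hv))
      fun h => hacyc X (h.tail hv)
  have hctrl : ∀ v ∈ C, ∀ ω n, g₀ (Function.update ω X n) v = g₀ ω v := fun v hv ω n =>
    hg₀.update_apply hacyc ω n (by rintro rfl; exact hCroot _ hv _ hYX) fun h => by
      obtain ⟨u, -, hu⟩ := Relation.TransGen.tail'_iff.1 h
      exact hCroot v hv u hu
  have hB : ∀ ω n,
      ((∀ v ∈ {u | E u X} \ ({Y} ∪ C), g₀ (Function.update ω X n) v = s v) ∧
        ∀ v ∈ C, g₀ (Function.update ω X n) v = c v) ↔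
      ((∀ v ∈ {u | E u X} \ ({Y} ∪ C), g₀ ω v = s v) ∧ ∀ v ∈ C, g₀ ω v = c v) := fun ω n =>
    and_congr (forall₂_congr fun v hv => by rw [hpar v hv.1])
      (forall₂_congr fun v hv => by rw [hctrl v hv])
  rw [hg₀.prob_eq_and x _ _ hB hval,
    hg₀.prob_eq_and x _
      (fun w => w Y = y ∧ (∀ v ∈ {u | E u X} \ ({Y} ∪ C), w v = s v) ∧ ∀ v ∈ C, w v = c v)
      (fun ω n => and_congr (by rw [hpar Y hYX]) (hB ω n)) fun w n hw => hval w n hw.2]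
  ring
end

section
/- Let M be a structural equation model (SEM) over a DAG G=(V,E) with finite discrete variables, observed variables N ⊆ V, control variables C ⊆ Λ_G (the observed roots of G), and strictly positive observational distribution P^M(N). Let (Y,X) ∈ E and c ∈ D_C be such that under the intervention do(C=c) the structural function of X does not depend on Y, and suppose in addition that Pa_X ∩ C = ∅. Then X ⟂ Y | Pa_X\{Y} holds in P^M (an ordinary conditional independence, not merely context-specific); consequently the edge (Y,X) can be deleted from G, i.e., the DAG (V, E\{(Y,X)}) is still a causal graph for the joint distribution P^M(V). -/
open Finset

theorem Acyclic.wellFounded {V : Type} [Finite V] {E : V → V → Prop} (h : Acyclic E) :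
    WellFounded E := by
  have : Std.Irrefl (Relation.TransGen E) := ⟨h⟩
  exact Subrelation.wf (fun hab => Relation.TransGen.single hab)
    (Finite.wellFounded_of_trans_of_irrefl (Relation.TransGen E))

namespace SEM

variable {V : Type} [Fintype V] [DecidableEq V] {E : V → V → Prop}
  {D : V → Type} [∀ v, Fintype (D v)] [∀ v, DecidableEq (D v)]

/-- Variables that are not descendants of `X` do not depend on the noise of `X`. -/
theorem IsObsSolution.eq_of_noise_eq_off {M : SEM V E D} (hacyc : Acyclic E)
    {g : M.Ω → ∀ v, D v} (hg : M.IsObsSolution g) {X : V} {ω ω' : M.Ω}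
    (hω : ∀ v, v ≠ X → ω v = ω' v) (v : V) (hv : ¬ Relation.ReflTransGen E X v) :
    g ω v = g ω' v := by
  induction v using hacyc.wellFounded.induction with
  | _ v ih =>
    have hvX : v ≠ X := by
      rintro rfl
      exact hv .refl
    rw [hg ω v, hg ω' v, hω v hvX]
    exact M.f_parents v _ _ _ fun u hu => ih u hu fun h => hv (h.tail hu)

/-- An event on the noise of `X` is independent of an event not depending on that noise. -/
theorem sum_W_noise_and (M : SEM V E D) (X : V) (p : Fin (M.noiseCard X) → Prop)
    (B : M.Ω → Prop) (hB : ∀ ω ω' : M.Ω, (∀ v, v ≠ X → ω v = ω' v) → (B ω ↔ B ω'))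
    [DecidablePred p] [DecidablePred B] [DecidablePred fun ω : M.Ω => p (ω X) ∧ B ω] :
    ∑ ω with p (ω X) ∧ B ω, M.W ω =
      (∑ n with p n, M.noiseDist X n) * ∑ ω with B ω, M.W ω := by
  simp only [Finset.sum_filter]
  let e := Equiv.piSplitAt X fun v => Fin (M.noiseCard v)
  let n₀ : Fin (M.noiseCard X) := ⟨0, M.noisePos X⟩
  have hW (n) (η) : M.W (e.symm (n, η)) = M.noiseDist X n *
      ∏ v : {v // v ≠ X}, M.noiseDist v (η v) := by
    rw [W, Fintype.prod_eq_mul_prod_subtype_ne _ X]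
    congr 1
    · simp [e, Equiv.piSplitAt]
    · refine Finset.prod_congr rfl fun v _ => ?_
      simp [e, Equiv.piSplitAt, v.2]
  have hX (n) (η) : e.symm (n, η) X = n := by simp [e, Equiv.piSplitAt]
  have hBe (n) (η) : B (e.symm (n, η)) ↔ B (e.symm (n₀, η)) :=
    hB _ _ fun v hv => by simp [e, Equiv.piSplitAt, hv]
  rw [← e.symm.sum_comp, ← e.symm.sum_comp, Fintype.sum_prod_type, Fintype.sum_prod_type]
  simp only [hW, hX, hBe]
  have hfac (n) (q : Prop) [Decidable q] (a : ℝ) :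
      (if q then M.noiseDist X n * a else 0) = M.noiseDist X n * if q then a else 0 := by
    split_ifs <;> simp
  simp only [hfac, ← Finset.mul_sum, ← Finset.sum_mul, M.noiseDist_sum_one, one_mul]
  rw [Finset.sum_mul]
  refine Finset.sum_congr rfl fun n _ => ?_
  by_cases hp : p n <;> simp [hp]

end SEM

/-- Lemma 1 of the paper.  If `(Y,X)` is an edge of the causal
DAG, `C ⊆ Λ_G` is a set of observed-root control variables, the observational
distribution over the observed variables `N` is strictly positive, under
`do(C = c)` the structural function of `X` does not depend on `Y`, and moreover
`Pa_X ∩ C = ∅`, then `X ⟂ Y | Pa_X \ {Y}` holds in `P^M` (an ordinary conditional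
independence), and the edge `(Y,X)` can be deleted from the graph: there is a SEM
with causal graph `(V, E \ {(Y,X)})` inducing the same joint distribution. -/
theorem ci_and_edge_deletion_of_context_functional_independence
    {V : Type} [Fintype V] [DecidableEq V] {E : V → V → Prop}
    {D : V → Type} [∀ v, Fintype (D v)] [∀ v, DecidableEq (D v)]
    (M : SEM V E D) (hacyc : Acyclic E)
    (N C : Set V) (hCN : C ⊆ N) (hCroot : ∀ v ∈ C, IsRoot E v)
    (g₀ : M.Ω → ∀ v, D v) (hg₀ : M.IsObsSolution g₀)
    (hpos : ∀ (a : ∀ v, D v), 0 < M.prob g₀ (fun w => ∀ v ∈ N, w v = a v))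
    (X Y : V) (hYX : E Y X) (c : ∀ v, D v)
    (hf : ∀ (w w' : ∀ u, D u) (n : Fin (M.noiseCard X)),
      (∀ v ∈ C, w v = c v) → (∀ v ∈ C, w' v = c v) →
      (∀ u, u ≠ Y → w u = w' u) → M.f X w n = M.f X w' n)
    (hPaC : ∀ u, E u X → u ∉ C) :
    M.CondIndepOn g₀ X Y ({u | E u X} \ {Y}) (fun _ => True) ∧
      ∃ (M' : SEM V (fun u v => E u v ∧ ¬(u = Y ∧ v = X)) D)
        (g₀' : M'.Ω → ∀ v, D v),
          M'.IsObsSolution g₀' ∧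
          ∀ A : (∀ v, D v) → Prop, M'.prob g₀' A = M.prob g₀ A := by
  classical
  have hf' : ∀ (w w' : ∀ u, D u) (n : Fin (M.noiseCard X)),
      (∀ u, E u X → u ≠ Y → w u = w' u) → M.f X w n = M.f X w' n := by
    intro w w' n h
    let r : ∀ u, D u := fun u => if u ∈ C then c u else w u
    let r' : ∀ u, D u := Function.update r Y (w' Y)
    have hYC := hPaC Y hYX
    calc M.f X w n = M.f X r n :=
          M.f_parents X _ _ _ fun u hu => by simp [r, hPaC u hu]
      _ = M.f X r' n := hf _ _ _ (fun v hv => by simp [r, hv])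
          (fun v hv => by
            have hvY : v ≠ Y := fun h => hYC (h ▸ hv)
            simp [r', r, hv, hvY])
          (fun u hu => by simp [r', hu])
      _ = M.f X w' n := M.f_parents X _ _ _ fun u hu => by
          by_cases huY : u = Y
          · subst huY; simp [r']
          · simp [r', r, huY, hPaC u hu, h u hu huY]
  refine ⟨fun x y s => ?_, ?_⟩
  · have hinv {ω ω' : M.Ω} (hω : ∀ v, v ≠ X → ω v = ω' v) {v : V} (hv : E v X) :
        g₀ ω v = g₀ ω' v :=
      hg₀.eq_of_noise_eq_off hacyc hω v fun h => hacyc X (.tail' h hv)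
    have hS {ω ω' : M.Ω} (hω : ∀ v, v ≠ X → ω v = ω' v) :
        (∀ v ∈ {u | E u X} \ {Y}, g₀ ω v = s v) ↔
          ∀ v ∈ {u | E u X} \ {Y}, g₀ ω' v = s v :=
      forall₂_congr fun v hv => by rw [hinv hω hv.1]
    have key (Q : (∀ v, D v) → Prop)
        (hQ : ∀ ω ω' : M.Ω, (∀ v, v ≠ X → ω v = ω' v) → (Q (g₀ ω) ↔ Q (g₀ ω')))
        (hQS : ∀ w, Q w → ∀ v ∈ {u | E u X} \ {Y}, w v = s v) :
        M.prob g₀ (fun w => w X = x ∧ Q w) =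
          (∑ n with M.f X s n = x, M.noiseDist X n) * M.prob g₀ Q := by
      have hev (ω : M.Ω) : (g₀ ω X = x ∧ Q (g₀ ω)) ↔ (M.f X s (ω X) = x ∧ Q (g₀ ω)) :=
        and_congr_left fun h => by
          rw [hg₀ ω X, hf' (g₀ ω) s (ω X) fun u hu huY => hQS _ h u ⟨hu, huY⟩]
      have h := M.sum_W_noise_and X (fun n => M.f X s n = x) (fun ω => Q (g₀ ω)) hQ
      unfold SEM.prob
      convert h using 2
      ext ω
      simpa using hev ω
    rw [key (fun w => w Y = y ∧ (∀ v ∈ {u | E u X} \ {Y}, w v = s v) ∧ True)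
        (fun ω ω' hω => by rw [hinv hω hYX, hS hω]) (fun w h => h.2.1),
      key (fun w => (∀ v ∈ {u | E u X} \ {Y}, w v = s v) ∧ True)
        (fun ω ω' hω => by rw [hS hω]) (fun w h => h.1)]
    ring
  · refine ⟨{ M with f_parents := fun v w w' n h => ?_ }, g₀, hg₀, fun A => rfl⟩
    by_cases hv : v = X
    · subst hv
      exact hf' w w' n fun u hu huY => h u ⟨hu, fun h => huY h.1⟩
    · exact M.f_parents v w w' n fun u hu => h u ⟨hu, fun h => hv h.2⟩
end

section
/- Let M be a structural equation model (SEM) over a DAG G=(V,E) with finite discrete variables, observed variables N ⊆ V, control variables C ⊆ Λ_G (the observed roots of G), and strictly positive observational distribution P^M(N). Let (Y,X) ∈ E and c1 ∈ D_C be such that under the intervention do(C=c1) the structural function of X does not depend on Y. If c2 ∈ D_C is any realization of C that agrees with c1 on C^X := Pa_X ∩ C (i.e., c1^X = c2^X), then the context-specific independence relation X ⟂ Y | C=c2, Pa_X\({Y}∪C) holds in P^M, i.e., the edge (Y,X) may be added to the label set entry L_C(c2). -/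
open Finset

namespace SEM

section Independence

variable {V : Type} [Fintype V] [DecidableEq V] {E : V → V → Prop}
  {D : V → Type} [∀ v, Fintype (D v)] [∀ v, DecidableEq (D v)]

theorem sum_W_mul_eq (M : SEM V E D) (X : V) (a : Fin (M.noiseCard X) → ℝ) (b : M.Ω → ℝ)
    (hb : ∀ ω n, b (Function.update ω X n) = b ω) :
    ∑ ω, M.W ω * (a (ω X) * b ω) =
      (∑ n, M.noiseDist X n * a n) * ∑ ω, M.W ω * b ω := by
  have hswap : ∀ n (ω : M.Ω), M.noiseDist X n * M.W ω =
      M.noiseDist X (ω X) * M.W (Function.update ω X n) := by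
    intro n ω
    unfold W
    rw [← Finset.mul_prod_erase univ _ (mem_univ X),
      ← Finset.mul_prod_erase univ (fun v => M.noiseDist v (Function.update ω X n v))
        (mem_univ X),
      Finset.prod_congr rfl fun v hv => by
        rw [← Function.update_of_ne (Finset.ne_of_mem_erase hv) n ω]]
    simp only [Function.update_self]
    ring
  calc ∑ ω, M.W ω * (a (ω X) * b ω)
      = (∑ n, M.noiseDist X n) * ∑ ω, M.W ω * (a (ω X) * b ω) := by
        rw [M.noiseDist_sum_one, one_mul]
    _ = ∑ p : Fin (M.noiseCard X) × M.Ω,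
          M.noiseDist X p.1 * (M.W p.2 * (a (p.2 X) * b p.2)) := by
        rw [Finset.sum_mul_sum, Fintype.sum_prod_type]
    _ = ∑ p : Fin (M.noiseCard X) × M.Ω,
          M.noiseDist X p.1 * a p.1 * (M.W p.2 * b p.2) := by
        have hinv : Function.Involutive fun p : Fin (M.noiseCard X) × M.Ω =>
            (p.2 X, Function.update p.2 X p.1) := by
          rintro ⟨n, ω⟩
          simp
        refine Fintype.sum_equiv hinv.toPerm _ _ ?_
        rintro ⟨n, ω⟩
        simp only [Function.Involutive.coe_toPerm, hb]
        linear_combination (a (ω X) * b ω) * hswap n ω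
    _ = (∑ n, M.noiseDist X n * a n) * ∑ ω, M.W ω * b ω := by
        rw [Finset.sum_mul_sum, Fintype.sum_prod_type]

open scoped Classical in
theorem prob_eq_sum (M : SEM V E D) (g : M.Ω → ∀ v, D v) (A : (∀ v, D v) → Prop) :
    M.prob g A = ∑ ω, M.W ω * if A (g ω) then 1 else 0 := by
  unfold prob
  rw [Finset.sum_filter]
  exact Finset.sum_congr rfl fun ω _ => by split_ifs <;> simp

open scoped Classical in
theorem prob_eq_mul_of_indep (M : SEM V E D) (g : M.Ω → ∀ v, D v) (X : V)
    (a : Fin (M.noiseCard X) → Prop) {A B : (∀ v, D v) → Prop}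
    (hA : ∀ ω, A (g ω) ↔ a (ω X) ∧ B (g ω))
    (hB : ∀ ω n, B (g (Function.update ω X n)) ↔ B (g ω)) :
    M.prob g A = (∑ n, M.noiseDist X n * if a n then 1 else 0) * M.prob g B := by
  rw [prob_eq_sum, prob_eq_sum,
    ← M.sum_W_mul_eq X (fun n => if a n then 1 else 0) (fun ω => if B (g ω) then 1 else 0)
      fun ω n => by simp only [hB]]
  refine Finset.sum_congr rfl fun ω _ => ?_
  simp only [hA, ite_and]
  split_ifs <;> simp

/-- The noise of `X` only affects `X` and its descendants. -/
theorem IsObsSolution.update_apply_of_not_reflTransGen {M : SEM V E D} {g : M.Ω → ∀ v, D v}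
    (hg : M.IsObsSolution g) (hacyc : Acyclic E) {X : V} (ω : M.Ω) (n : Fin (M.noiseCard X))
    {v : V} (hv : ¬ Relation.ReflTransGen E X v) :
    g (Function.update ω X n) v = g ω v := by
  induction v using hacyc.wellFounded.induction with
  | _ v ih =>
    have hne : v ≠ X := fun h => hv (h ▸ .refl)
    rw [hg _ v, hg ω v, Function.update_of_ne hne]
    exact M.f_parents v _ _ _ fun u hu => ih u hu fun h => hv (h.tail hu)

end Independence

end SEM

/-- Corollary 1 of the paper.  If `(Y,X)` is an edge of the
causal DAG, `C ⊆ Λ_G` is a set of observed-root control variables, the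
observational distribution over the observed variables `N` is strictly positive,
under `do(C = c₁)` the structural function of `X` does not depend on `Y`, and
`c₂` agrees with `c₁` on `C^X := Pa_X ∩ C`, then the context-specific
independence `X ⟂ Y | C = c₂, Pa_X \ ({Y} ∪ C)` holds in `P^M`, i.e. `(Y,X)`
may be added to the label set entry `L_C(c₂)`. -/
theorem csi_transfers_to_agreeing_context
    {V : Type} [Fintype V] [DecidableEq V] {E : V → V → Prop}
    {D : V → Type} [∀ v, Fintype (D v)] [∀ v, DecidableEq (D v)]
    (M : SEM V E D) (hacyc : Acyclic E)
    (N C : Set V) (hCN : C ⊆ N) (hCroot : ∀ v ∈ C, IsRoot E v)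
    (g₀ : M.Ω → ∀ v, D v) (hg₀ : M.IsObsSolution g₀)
    (hpos : ∀ (a : ∀ v, D v), 0 < M.prob g₀ (fun w => ∀ v ∈ N, w v = a v))
    (X Y : V) (hYX : E Y X) (c₁ c₂ : ∀ v, D v)
    (hf : ∀ (w w' : ∀ u, D u) (n : Fin (M.noiseCard X)),
      (∀ v ∈ C, w v = c₁ v) → (∀ v ∈ C, w' v = c₁ v) →
      (∀ u, u ≠ Y → w u = w' u) → M.f X w n = M.f X w' n)
    (hagree : ∀ v ∈ C, E v X → c₁ v = c₂ v) :
    M.CondIndepOn g₀ X Y ({u | E u X} \ ({Y} ∪ C))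
      (fun w => ∀ v ∈ C, w v = c₂ v) := by
  intro x y s
  classical
  let w₀ : ∀ u, D u := fun u => if u ∈ C then c₁ u else s u
  have hnd : ∀ v, E v X → ¬ Relation.ReflTransGen E X v := fun v hv h =>
    hacyc X (Relation.TransGen.tail' h hv)
  have hndC : ∀ v ∈ C, ¬ Relation.ReflTransGen E X v := by
    intro v hv h
    rcases h.cases_tail with rfl | ⟨u, -, hu⟩
    · exact hCroot _ hv Y hYX
    · exact hCroot v hv u hu
  have hupd := fun ω n v => hg₀.update_apply_of_not_reflTransGen hacyc (X := X) ω n (v := v)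
  have hX : ∀ ω, (∀ v ∈ {u | E u X} \ ({Y} ∪ C), g₀ ω v = s v) → (∀ v ∈ C, g₀ ω v = c₂ v) →
      g₀ ω X = M.f X w₀ (ω X) := by
    intro ω hs hc
    let w : ∀ u, D u := fun u => if u ∈ C then c₁ u else g₀ ω u
    let w' : ∀ u, D u := fun u => if u ∈ C then c₁ u else if u = Y then s u else g₀ ω u
    calc g₀ ω X = M.f X (g₀ ω) (ω X) := hg₀ ω X
      _ = M.f X w (ω X) := M.f_parents X _ _ _ fun u hu => by
          by_cases huC : u ∈ C
          · simp only [w, if_pos huC, hc u huC, hagree u huC hu]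
          · simp only [w, if_neg huC]
      _ = M.f X w' (ω X) := hf _ _ _ (fun v hv => if_pos hv) (fun v hv => if_pos hv)
          fun u hu => by simp only [w, w', if_neg hu]
      _ = M.f X w₀ (ω X) := M.f_parents X _ _ _ fun u hu => by
          by_cases huC : u ∈ C
          · simp only [w', w₀, if_pos huC]
          · by_cases huY : u = Y
            · simp only [w', w₀, if_neg huC, if_pos huY]
            · simp only [w', w₀, if_neg huC, if_neg huY]
              exact hs u ⟨hu, by simp [huC, huY]⟩
  let B : (∀ v, D v) → Prop := fun w =>
    (∀ v ∈ {u | E u X} \ ({Y} ∪ C), w v = s v) ∧ ∀ v ∈ C, w v = c₂ v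
  have hB : ∀ ω n, B (g₀ (Function.update ω X n)) ↔ B (g₀ ω) := by
    intro ω n
    refine and_congr (forall₂_congr fun v hv => ?_) (forall₂_congr fun v hv => ?_)
    · rw [hupd ω n v (hnd v hv.1)]
    · rw [hupd ω n v (hndC v hv)]
  have hBY : ∀ ω n, (g₀ (Function.update ω X n) Y = y ∧ B (g₀ (Function.update ω X n))) ↔
      (g₀ ω Y = y ∧ B (g₀ ω)) := fun ω n =>
    and_congr (by rw [hupd ω n Y (hnd Y hYX)]) (hB ω n)
  change M.prob g₀ (fun w => w X = x ∧ w Y = y ∧ B w) * M.prob g₀ B =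
    M.prob g₀ (fun w => w X = x ∧ B w) * M.prob g₀ (fun w => w Y = y ∧ B w)
  rw [M.prob_eq_mul_of_indep g₀ X (fun n => M.f X w₀ n = x)
      (A := fun w => w X = x ∧ w Y = y ∧ B w) (B := fun w => w Y = y ∧ B w) (fun ω => and_congr_left fun h => by
        rw [hX ω h.2.1 h.2.2]) hBY,
    M.prob_eq_mul_of_indep g₀ X (fun n => M.f X w₀ n = x)
      (A := fun w => w X = x ∧ B w) (B := B)
      (fun ω => and_congr_left fun h => by rw [hX ω h.1 h.2]) hB]
  ring
end

section
/- Let H be a DAG with vertex set V, observed vertices N ⊆ V, and let X, Y ∈ N be distinct. Then there is no inducing path between X and Y in H if and only if X and Y are d-separated in H by the set (Anc_{{X,Y}} ∩ N) \ {X,Y}, where Anc_{{X,Y}} denotes the union of ancestors (including themselves) of X and Y in H. -/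
/-- All ancestors of `X` in the graph `E` (including `X` itself). -/
def Ancestors {V : Type} (E : V → V → Prop) (X : V) : Set V :=
  {u | Relation.ReflTransGen E u X}

/-- `p` is an (undirected) path in the graph `E`: consecutive vertices are
adjacent (in either direction) and no vertex repeats. -/
def IsPath {V : Type} (E : V → V → Prop) (p : List V) : Prop :=
  p.Chain' (fun u v => E u v ∨ E v u) ∧ p.Nodup

/-- The vertex at interior position `i` of the path `p` is a collider:
both neighboring edges on the path point into it. -/
def CollidesAt {V : Type} (E : V → V → Prop) (p : List V) (i : ℕ) : Prop :=
  0 < i ∧ i + 1 < p.length ∧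
    ∃ a b c, p[i - 1]? = some a ∧ p[i]? = some b ∧ p[i + 1]? = some c ∧
      E a b ∧ E c b

/-- The path `p` is blocked by the set `S`: it contains an interior non-collider
belonging to `S`, or an interior collider that is neither in `S` nor an ancestor
of any member of `S`. -/
def Blocked {V : Type} (E : V → V → Prop) (S : Set V) (p : List V) : Prop :=
  ∃ i b, 0 < i ∧ i + 1 < p.length ∧ p[i]? = some b ∧
    ((¬ CollidesAt E p i ∧ b ∈ S) ∨
      (CollidesAt E p i ∧ b ∉ S ∧ ∀ s ∈ S, b ∉ Ancestors E s))

/-- `X` and `Y` are d-separated by `S` in the graph `E`: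
every path between them is blocked by `S`. -/
def DSep {V : Type} (E : V → V → Prop) (X Y : V) (S : Set V) : Prop :=
  ∀ p : List V, IsPath E p → p.head? = some X → p.getLast? = some Y →
    Blocked E S p

/-- A path `p` between the observed vertices `X` and `Y` is an inducing path
(w.r.t. the observed set `N`): every interior observed vertex is a collider,
and every interior collider is an ancestor of `X` or of `Y`. -/
def IsInducingPath {V : Type} (E : V → V → Prop) (N : Set V) (X Y : V)
    (p : List V) : Prop :=
  IsPath E p ∧ p.head? = some X ∧ p.getLast? = some Y ∧
    (∀ i b, 0 < i → i + 1 < p.length → p[i]? = some b → b ∈ N →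
      CollidesAt E p i) ∧
    (∀ i b, 0 < i → i + 1 < p.length → p[i]? = some b → CollidesAt E p i →
      b ∈ Ancestors E X ∪ Ancestors E Y)

/-- `p` is a path from `X` to `Y` all of whose interior colliders lie in `C` and all of whose
interior non-colliders lie outside `S`. -/
structure IsConnectingPath {V : Type} (E : V → V → Prop) (C S : Set V) (X Y : V)
    (p : List V) : Prop where
  isPath : IsPath E p
  head : p.head? = some X
  last : p.getLast? = some Y
  collider : ∀ i b, 0 < i → i + 1 < p.length → p[i]? = some b → CollidesAt E p i → b ∈ C
  nonCollider : ∀ i b, 0 < i → i + 1 < p.length → p[i]? = some b → ¬ CollidesAt E p i → b ∉ S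

/-- The vertices with a directed walk to `Y` on which every vertex other than the final `Y`
lies outside `N`. -/
def HiddenAncestors {V : Type} (E : V → V → Prop) (N : Set V) (Y : V) : Set V :=
  {w | Relation.ReflTransGen (fun a b => E a b ∧ a ∉ N) w Y}

section

variable {V : Type} {E : V → V → Prop} {C S N : Set V} {X Y : V} {p : List V}

theorem collidesAt_congr {q : List V} {i j : ℕ} (hi : 0 < i) (hi' : i + 1 < p.length)
    (hj : 0 < j) (hj' : j + 1 < q.length) (h₀ : p[i]? = q[j]?)
    (h : p[i - 1]? = q[j - 1]? ∧ p[i + 1]? = q[j + 1]? ∨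
      p[i - 1]? = q[j + 1]? ∧ p[i + 1]? = q[j - 1]?) :
    CollidesAt E p i ↔ CollidesAt E q j := by
  unfold CollidesAt
  grind

theorem IsConnectingPath.reverse (h : IsConnectingPath E C S X Y p) :
    IsConnectingPath E C S Y X p.reverse := by
  obtain ⟨⟨hc, hn⟩, hh, hl, h1, h2⟩ := h
  have key : ∀ i b, 0 < i → i + 1 < p.reverse.length → p.reverse[i]? = some b →
      p[p.length - 1 - i]? = some b ∧
      (CollidesAt E p.reverse i ↔ CollidesAt E p (p.length - 1 - i)) := by
    intro i b hi hi' hb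
    rw [List.length_reverse] at hi'
    refine ⟨by rw [← hb, List.getElem?_reverse (by omega)], ?_⟩
    refine collidesAt_congr hi (by simpa using hi') (by omega) (by omega)
      (List.getElem?_reverse' (by omega))
      (Or.inr ⟨List.getElem?_reverse' (by omega), List.getElem?_reverse' (by omega)⟩)
  refine ⟨⟨?_, List.nodup_reverse.2 hn⟩, by simpa using hl, by simpa using hh, ?_, ?_⟩
  · exact List.isChain_reverse.2 (List.IsChain.imp (fun _ _ h => h.symm) hc)
  · intro i b hi hi' hb hcol
    obtain ⟨k1, k2⟩ := key i b hi hi' hb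
    rw [List.length_reverse] at hi'
    exact h1 _ b (by omega) (by omega) k1 (k2.1 hcol)
  · intro i b hi hi' hb hcol
    obtain ⟨k1, k2⟩ := key i b hi hi' hb
    rw [List.length_reverse] at hi'
    exact h2 _ b (by omega) (by omega) k1 (mt k2.2 hcol)

theorem List.IsChain.nodup_of_acyclic (hacyc : ∀ v, ¬ Relation.TransGen E v v)
    (h : p.IsChain E) : p.Nodup := by
  have h' : p.IsChain (Relation.TransGen E) := h.imp fun _ _ => Relation.TransGen.single
  refine (List.isChain_iff_pairwise.1 h').imp ?_
  rintro a b hab rfl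
  exact hacyc _ hab

theorem List.exists_append_cons_of_exists_mem {P : V → Prop} {l : List V} (h : ∃ v ∈ l, P v) :
    ∃ l₁ w l₂, l = l₁ ++ w :: l₂ ∧ P w ∧ ∀ v ∈ l₁, ¬ P v := by
  induction l with
  | nil => simp at h
  | cons a l ih =>
    by_cases ha : P a
    · exact ⟨[], a, l, rfl, ha, by simp⟩
    · obtain ⟨l₁, w, l₂, rfl, hw, h₁⟩ := ih (by grind)
      exact ⟨a :: l₁, w, l₂, rfl, hw, by grind⟩

/-- A connecting path can be rerouted so that its colliders avoid the hidden ancestors of its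
endpoint `Y`: follow it up to the first hidden ancestor of `Y`, then go directly to `Y`. -/
theorem IsConnectingPath.exists_collider_notMem_hiddenAncestors
    (hacyc : ∀ v, ¬ Relation.TransGen E v v) (hSN : S ⊆ N)
    (h : IsConnectingPath E C S X Y p) :
    ∃ q, IsConnectingPath E (C \ HiddenAncestors E N Y) S X Y q := by
  obtain ⟨⟨hc, hn⟩, hh, hl, h1, h2⟩ := h
  obtain ⟨l₁, w, l₂, rfl, hw, hl₁⟩ := List.exists_append_cons_of_exists_mem
    (P := (· ∈ HiddenAncestors E N Y))
    ⟨Y, List.mem_of_getLast? hl, Relation.ReflTransGen.refl⟩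
  obtain ⟨d, hd, hdl⟩ := List.exists_isChain_cons_of_relationReflTransGen hw
  have hdE : (w :: d).IsChain E := hd.imp fun _ _ h => h.1
  have hdU : ∀ v ∈ w :: d, v ∈ HiddenAncestors E N Y :=
    hd.backwards_induction (· ∈ HiddenAncestors E N Y) _
      (fun _ _ hab hb => Relation.ReflTransGen.head hab hb)
      (fun _ => hdl ▸ Relation.ReflTransGen.refl)
  have hdi := List.isChain_iff_getElem.1 hd
  have hasymm : ∀ a b, E a b → ¬ E b a := fun a b hab hba =>
    hacyc a (.tail (.single hab) hba)
  have hlow : ∀ i, i ≤ l₁.length → (l₁ ++ w :: d)[i]? = (l₁ ++ w :: l₂)[i]? := by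
    intro i hi
    grind
  have hcongr : ∀ i, 0 < i → i < l₁.length →
      (CollidesAt E (l₁ ++ w :: d) i ↔ CollidesAt E (l₁ ++ w :: l₂) i) := fun i hi hi' =>
    collidesAt_congr hi (by simp; omega) hi (by simp; omega) (hlow _ (by omega))
      (Or.inl ⟨hlow _ (by omega), hlow _ (by omega)⟩)
  have hhigh : ∀ i b, l₁.length ≤ i → i + 1 < (l₁ ++ w :: d).length →
      (l₁ ++ w :: d)[i]? = some b → b ∉ N ∧ ¬ CollidesAt E (l₁ ++ w :: d) i := by
    intro i b hi hi' hb
    obtain ⟨k, rfl⟩ := Nat.exists_eq_add_of_le hi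
    have hk : k + 1 < (w :: d).length := by simp at hi' ⊢; omega
    have hb' : (w :: d)[k] = b := by
      rw [List.getElem?_append_right hi, Nat.add_sub_cancel_left] at hb
      exact (List.getElem?_eq_some_iff.1 hb).2
    have hn' : (l₁ ++ w :: d)[l₁.length + k + 1]? = some (w :: d)[k + 1] := by
      rw [List.getElem?_append_right (by omega), Nat.add_assoc, Nat.add_sub_cancel_left]
      exact List.getElem?_eq_getElem hk
    have hstep := hdi k hk
    rw [hb'] at hstep
    refine ⟨hstep.2, ?_⟩
    rintro ⟨-, -, a, b', c, -, hb₂, hc₂, -, hcb⟩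
    rw [hb] at hb₂
    rw [hn'] at hc₂
    obtain rfl := Option.some.inj hb₂
    obtain rfl := Option.some.inj hc₂
    exact hasymm _ _ hstep.1 hcb
  refine ⟨l₁ ++ w :: d, ⟨?_, ?_⟩, ?_, ?_, ?_, ?_⟩
  · exact List.isChain_split.2 ⟨(List.isChain_split.1 hc).1, hdE.imp fun _ _ => Or.inl⟩
  · refine List.nodup_append.2 ⟨(List.nodup_append.1 hn).1, hdE.nodup_of_acyclic hacyc, ?_⟩
    rintro a ha b hb rfl
    exact hl₁ a ha (hdU a hb)
  · cases l₁ <;> simpa using hh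
  · rw [List.getLast?_append_of_ne_nil _ (by simp), List.getLast?_eq_getLast_of_ne_nil (by simp),
      hdl]
  · intro i b hi hi' hb hcol
    by_cases hil : i < l₁.length
    · rw [hcongr i hi hil] at hcol
      refine ⟨h1 i b hi (by simp; omega) (hlow i hil.le ▸ hb) hcol, hl₁ b ?_⟩
      rw [List.getElem?_append_left hil] at hb
      exact List.mem_of_getElem? hb
    · exact absurd hcol (hhigh i b (by omega) hi' hb).2
  · intro i b hi hi' hb hcol
    by_cases hil : i < l₁.length
    · rw [hcongr i hi hil] at hcol
      exact h2 i b hi (by simp; omega) (hlow i hil.le ▸ hb) hcol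
    · exact fun hbS => (hhigh i b (by omega) hi' hb).1 (hSN hbS)

/-- A vertex left along a path by an outgoing edge is an ancestor of a later collider or of the
endpoint. -/
theorem IsConnectingPath.mem_of_edge_succ (hacyc : ∀ v, ¬ Relation.TransGen E v v)
    (hC : ∀ u v, E u v → v ∈ C → u ∈ C) (hY : Y ∈ C) (h : IsConnectingPath E C S X Y p)
    (i : ℕ) (hi : i + 1 < p.length) (hE : E p[i] p[i + 1]) : p[i] ∈ C := by
  refine hC _ _ hE ?_
  by_cases hi' : i + 2 < p.length
  · have hadj := List.isChain_iff_getElem.1 h.isPath.1 (i + 1) hi'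
    by_cases hE' : E p[i + 1] p[i + 2]
    · exact h.mem_of_edge_succ hacyc hC hY (i + 1) hi' hE'
    · refine h.collider (i + 1) _ (by omega) hi' (List.getElem?_eq_getElem hi)
        ⟨by omega, hi', p[i], p[i + 1], p[i + 2], ?_, ?_, ?_, hE, hadj.resolve_left hE'⟩ <;> simp
  · have hl := h.last
    rw [List.getLast?_eq_getElem?, show p.length - 1 = i + 1 by omega,
      List.getElem?_eq_getElem hi] at hl
    exact Option.some.inj hl ▸ hY
termination_by p.length - i

theorem IsConnectingPath.mem_of_mem (hacyc : ∀ v, ¬ Relation.TransGen E v v)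
    (hC : ∀ u v, E u v → v ∈ C → u ∈ C) (hX : X ∈ C) (hY : Y ∈ C)
    (h : IsConnectingPath E C S X Y p) {i : ℕ} (hi : 0 < i) (hi' : i + 1 < p.length) :
    p[i] ∈ C := by
  by_cases hE : E p[i] p[i + 1]
  · exact h.mem_of_edge_succ hacyc hC hY i hi' hE
  obtain ⟨i, rfl⟩ : ∃ j, i = j + 1 := ⟨i - 1, by omega⟩
  have hadj := List.isChain_iff_getElem.1 h.isPath.1
  by_cases hE' : E p[i + 1] p[i]
  · have hr := h.reverse.mem_of_edge_succ hacyc hC hX (p.length - 1 - (i + 1)) (by simp; omega)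
    simp only [List.getElem_reverse] at hr
    have e₁ : p.length - 1 - (p.length - 1 - (i + 1)) = i + 1 := by omega
    have e₂ : p.length - 1 - (p.length - 1 - (i + 1) + 1) = i := by omega
    simp only [e₁, e₂] at hr
    exact hr hE'
  · refine h.collider (i + 1) _ (by omega) hi' (List.getElem?_eq_getElem _)
      ⟨by omega, hi', p[i], p[i + 1], p[i + 2], ?_, ?_, ?_,
        (hadj i (by omega)).resolve_right hE', (hadj (i + 1) hi').resolve_left hE⟩ <;> simp

theorem dSep_iff_not_exists_isConnectingPath :
    DSep E X Y S ↔
      ¬ ∃ p, IsConnectingPath E {b | ∃ s ∈ S, b ∈ Ancestors E s} S X Y p := by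
  constructor
  · rintro h ⟨p, hp⟩
    obtain ⟨i, b, hi, hi', hb, ⟨hcol, hbS⟩ | ⟨hcol, -, hbA⟩⟩ := h p hp.isPath hp.head hp.last
    · exact hp.nonCollider i b hi hi' hb hcol hbS
    · obtain ⟨s, hs, hbs⟩ := hp.collider i b hi hi' hb hcol
      exact hbA s hs hbs
  · intro h p hp hh hl
    by_contra hB
    refine h ⟨p, hp, hh, hl, fun i b hi hi' hb hcol => ?_, fun i b hi hi' hb hcol hbS => ?_⟩
    · by_contra hbA
      refine hB ⟨i, b, hi, hi', hb, Or.inr ⟨hcol, fun hbS => hbA ?_, fun s hs hbs => hbA ?_⟩⟩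
      · exact ⟨b, hbS, Relation.ReflTransGen.refl⟩
      · exact ⟨s, hs, hbs⟩
    · exact hB ⟨i, b, hi, hi', hb, Or.inl ⟨hcol, hbS⟩⟩

theorem isInducingPath_iff_isConnectingPath :
    IsInducingPath E N X Y p ↔
      IsConnectingPath E (Ancestors E X ∪ Ancestors E Y) N X Y p := by
  constructor
  · rintro ⟨hp, hh, hl, hN, hcol⟩
    exact ⟨hp, hh, hl, hcol, fun i b hi hi' hb hn hbN => hn (hN i b hi hi' hb hbN)⟩
  · rintro ⟨hp, hh, hl, hcol, hN⟩
    refine ⟨hp, hh, hl, fun i b hi hi' hb hbN => ?_, hcol⟩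
    by_contra hn
    exact hN i b hi hi' hb hn hbN

theorem IsConnectingPath.mono {C' S' : Set V} (hC : C ⊆ C') (hS : S' ⊆ S)
    (h : IsConnectingPath E C S X Y p) : IsConnectingPath E C' S' X Y p :=
  ⟨h.isPath, h.head, h.last, fun i b hi hi' hb hc => hC (h.collider i b hi hi' hb hc),
    fun i b hi hi' hb hc hbS => h.nonCollider i b hi hi' hb hc (hS hbS)⟩

/-- From an ancestor `b` of `Z`, a directed walk to `Z` either meets `S` or stays hidden until it
reaches `X` or `Y`. -/
theorem mem_hiddenAncestors_of_mem_ancestors {A : Set V} (hA : ∀ u v, E u v → v ∈ A → u ∈ A)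
    {Z : V} (hZ : Z ∈ A) (hZXY : Z = X ∨ Z = Y) {b : V} (hb : b ∈ Ancestors E Z) :
    b ∈ {b | ∃ s ∈ (A ∩ N) \ {X, Y}, b ∈ Ancestors E s} ∪ HiddenAncestors E N X ∪
      HiddenAncestors E N Y := by
  suffices b ∈ A ∧ b ∈ {b | ∃ s ∈ (A ∩ N) \ {X, Y}, b ∈ Ancestors E s} ∪
      HiddenAncestors E N X ∪ HiddenAncestors E N Y from this.2
  induction hb using Relation.ReflTransGen.head_induction_on with
  | refl =>
    refine ⟨hZ, ?_⟩
    rcases hZXY with rfl | rfl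
    · exact Or.inl (Or.inr .refl)
    · exact Or.inr .refl
  | @head u v huv _ ih =>
    have huA := hA u v huv ih.1
    refine ⟨huA, ?_⟩
    by_cases huN : u ∈ N
    · by_cases huX : u = X
      · exact Or.inl (Or.inr (huX ▸ .refl))
      by_cases huY : u = Y
      · exact Or.inr (huY ▸ .refl)
      · exact Or.inl (Or.inl ⟨u, ⟨⟨huA, huN⟩, by simp [huX, huY]⟩, .refl⟩)
    · rcases ih.2 with (⟨s, hs, hvs⟩ | h) | h
      · exact Or.inl (Or.inl ⟨s, hs, .head huv hvs⟩)
      · exact Or.inl (Or.inr (.head ⟨huv, huN⟩ h))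
      · exact Or.inr (.head ⟨huv, huN⟩ h)

end

/-- Lemma 4, Verma–Pearl.  In a DAG `H` with observed vertices
`N` and distinct observed vertices `X, Y ∈ N`, there is no inducing path between
`X` and `Y` iff `X` and `Y` are d-separated by `(Anc_{{X,Y}} ∩ N) \ {X, Y}`. -/
theorem no_inducing_path_iff_dsep_by_observed_ancestors
    {V : Type} (E : V → V → Prop) (hacyc : ∀ v, ¬ Relation.TransGen E v v)
    (N : Set V) (X Y : V) (hX : X ∈ N) (hY : Y ∈ N) (hXY : X ≠ Y) :
    (¬ ∃ p : List V, IsInducingPath E N X Y p) ↔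
      DSep E X Y (((Ancestors E X ∪ Ancestors E Y) ∩ N) \ {X, Y}) := by
  rw [dSep_iff_not_exists_isConnectingPath, not_iff_not]
  simp only [isInducingPath_iff_isConnectingPath]
  have hA : ∀ u v, E u v → v ∈ Ancestors E X ∪ Ancestors E Y →
      u ∈ Ancestors E X ∪ Ancestors E Y := fun u v huv =>
    Or.imp (Relation.ReflTransGen.head huv) (Relation.ReflTransGen.head huv)
  have hXA : X ∈ Ancestors E X ∪ Ancestors E Y := Or.inl .refl
  have hYA : Y ∈ Ancestors E X ∪ Ancestors E Y := Or.inr .refl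
  have hSN : ((Ancestors E X ∪ Ancestors E Y) ∩ N) \ {X, Y} ⊆ N := fun _ h => h.1.2
  constructor
  · rintro ⟨p, hp⟩
    have hcover : Ancestors E X ∪ Ancestors E Y ⊆ _ := Set.union_subset
      (fun b => mem_hiddenAncestors_of_mem_ancestors (N := N) hA hXA (Or.inl rfl))
      (fun b => mem_hiddenAncestors_of_mem_ancestors (N := N) hA hYA (Or.inr rfl))
    obtain ⟨q, hq⟩ := (hp.mono hcover hSN).exists_collider_notMem_hiddenAncestors hacyc hSN
    obtain ⟨r, hr⟩ := hq.reverse.exists_collider_notMem_hiddenAncestors hacyc hSN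
    refine ⟨r.reverse, hr.reverse.mono ?_ subset_rfl⟩
    rintro b ⟨⟨(h | h) | h, hbY⟩, hbX⟩
    exacts [h, absurd h hbX, absurd h hbY]
  · rintro ⟨p, hp⟩
    replace hp := hp.mono (C' := Ancestors E X ∪ Ancestors E Y) (by
      rintro b ⟨s, ⟨⟨hs, -⟩, -⟩, hbs⟩
      exact hs.imp (Relation.ReflTransGen.trans hbs) (Relation.ReflTransGen.trans hbs)) subset_rfl
    refine ⟨p, hp.isPath, hp.head, hp.last, hp.collider, fun i b hi hi' hb hcol hbN => ?_⟩
    obtain ⟨hip, rfl⟩ := List.getElem?_eq_some_iff.1 hb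
    refine hp.nonCollider i _ hi hi' hb hcol
      ⟨⟨hp.mem_of_mem hacyc hA hXA hYA hi hi', hbN⟩, ?_⟩
    have hh := hp.head
    have hl := hp.last
    rw [List.head?_eq_getElem?] at hh
    rw [List.getLast?_eq_getElem?] at hl
    rintro (h | h)
    · have := (hp.isPath.2.getElem_inj_iff (hi := hip) (hj := by omega)).1
        (h.trans (List.getElem?_eq_some_iff.1 hh).2.symm)
      omega
    · have := (hp.isPath.2.getElem_inj_iff (hi := hip) (hj := by omega)).1
        (h.trans (List.getElem?_eq_some_iff.1 hl).2.symm)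
      omega
end

section
/- Let H be a DAG with vertex set V, observed vertices N ⊆ V, and let X, Y ∈ N be distinct. If there exists some subset S ⊆ N \ {X,Y} that d-separates X and Y in H, then the specific set (Anc_{{X,Y}} ∩ N) \ {X,Y} d-separates X and Y in H, where Anc_{{X,Y}} denotes the union of ancestors (including themselves) of X and Y in H. -/
/-- The vertex `f (k + 1)` is a collider of the walk `f`. -/
def WalkCollides {V : Type} (E : V → V → Prop) (f : ℕ → V) (k : ℕ) : Prop :=
  E (f k) (f (k + 1)) ∧ E (f (k + 2)) (f (k + 1))

/-- The vertices that are ancestors of some member of `S`. -/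
def AncestorsOfSet {V : Type} (E : V → V → Prop) (S : Set V) : Set V :=
  {u | ∃ s ∈ S, Relation.ReflTransGen E u s}

/-- `f 0, …, f n` is a walk from `X` to `Y`, with repeated vertices allowed. -/
def IsWalk {V : Type} (E : V → V → Prop) (X Y : V) (f : ℕ → V) (n : ℕ) : Prop :=
  f 0 = X ∧ f n = Y ∧ ∀ k < n, E (f k) (f (k + 1)) ∨ E (f (k + 1)) (f k)

/-- On the walk `f 0, …, f n`, interior colliders lie in `T` and interior non-colliders
avoid `S`. -/
def WalkOpen {V : Type} (E : V → V → Prop) (T S : Set V) (f : ℕ → V) (n : ℕ) : Prop :=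
  ∀ k, k + 1 < n →
    (WalkCollides E f k → f (k + 1) ∈ T) ∧ (¬ WalkCollides E f k → f (k + 1) ∉ S)

section

variable {V : Type} {E : V → V → Prop}

theorem getElem?_map_range (f : ℕ → V) {n k : ℕ} (hk : k ≤ n) :
    ((List.range (n + 1)).map f)[k]? = some (f k) := by
  rw [List.getElem?_map, List.getElem?_range (by omega), Option.map_some]

theorem collidesAt_map_range_iff (f : ℕ → V) (n k : ℕ) :
    CollidesAt E ((List.range (n + 1)).map f) (k + 1) ↔ k + 1 < n ∧ WalkCollides E f k := by
  unfold CollidesAt WalkCollides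
  simp only [List.length_map, List.length_range]
  constructor
  · rintro ⟨-, h, a, b, c, ha, hb, hc, h1, h2⟩
    have hk : k + 1 < n := by omega
    rw [Nat.add_sub_cancel, getElem?_map_range f (by omega), Option.some_inj] at ha
    rw [getElem?_map_range f (by omega), Option.some_inj] at hb hc
    subst ha hb hc
    exact ⟨hk, h1, h2⟩
  · rintro ⟨hk, h1, h2⟩
    exact ⟨by omega, by omega, f k, f (k + 1), f (k + 2), getElem?_map_range f (by omega),
      getElem?_map_range f (by omega), getElem?_map_range f (by omega), h1, h2⟩

theorem not_blocked_map_range_iff (S : Set V) (f : ℕ → V) (n : ℕ) :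
    ¬ Blocked E S ((List.range (n + 1)).map f) ↔ WalkOpen E (AncestorsOfSet E S) S f n := by
  constructor
  · intro h k hk
    have hget := getElem?_map_range f hk.le
    constructor
    · intro hc
      by_contra hT
      refine h ⟨k + 1, f (k + 1), by omega, by simp [hk], hget, Or.inr
        ⟨(collidesAt_map_range_iff f n k).2 ⟨hk, hc⟩, ?_, ?_⟩⟩
      · exact fun hS => hT ⟨_, hS, .refl⟩
      · exact fun s hs hb => hT ⟨s, hs, hb⟩
    · intro hc hS
      exact h ⟨k + 1, f (k + 1), by omega, by simp [hk], hget, Or.inl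
        ⟨fun h' => hc ((collidesAt_map_range_iff f n k).1 h').2, hS⟩⟩
  · rintro h ⟨i, b, hi, hlen, hb, hor⟩
    obtain ⟨k, rfl⟩ : ∃ k, i = k + 1 := ⟨i - 1, by omega⟩
    have hk : k + 1 < n := by simpa using hlen
    rw [getElem?_map_range f hk.le, Option.some_inj] at hb
    subst hb
    rw [collidesAt_map_range_iff] at hor
    rcases hor with ⟨hc, hS⟩ | ⟨hc, hS, hs⟩
    · exact (h k hk).2 (fun h' => hc ⟨hk, h'⟩) hS
    · obtain ⟨s, hs', hr⟩ := (h k hk).1 hc.2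
      exact hs s hs' hr

theorem exists_eq_map_range {p : List V} {X Y : V} (hp : IsPath E p) (hX : p.head? = some X)
    (hY : p.getLast? = some Y) :
    ∃ f n, p = (List.range (n + 1)).map f ∧ IsWalk E X Y f n := by
  have hpos : 0 < p.length := by
    cases p with
    | nil => simp at hX
    | cons => simp
  refine ⟨fun k => p.getD k X, p.length - 1, ?_, ?_, ?_, ?_⟩
  · apply List.ext_getElem
    · simp; omega
    · intro i h1 h2
      simp [h1]
  · rw [List.head?_eq_getElem?] at hX
    simp [hX]
  · rw [List.getLast?_eq_getElem?] at hY
    simp [hY]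
  · intro k hk
    have h1 : k < p.length := by omega
    have h2 : k + 1 < p.length := by omega
    have := List.isChain_iff_getElem.1 hp.1 k h2
    simpa [h1, h2] using this

theorem isPath_map_range {X Y : V} {f : ℕ → V} {n : ℕ} (hf : IsWalk E X Y f n)
    (hinj : ∀ i j, i < j → j ≤ n → f i ≠ f j) : IsPath E ((List.range (n + 1)).map f) := by
  refine ⟨List.isChain_iff_getElem.2 fun k hk => ?_, ?_⟩
  · have := hf.2.2 k (by simpa using hk)
    simpa using this
  · rw [List.nodup_iff_pairwise_ne, List.pairwise_iff_getElem]
    intro i j hi hj hij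
    simpa using hinj i j hij (by rw [List.length_map, List.length_range] at hj; omega)

/-- A walk segment whose first edge points forward and whose last edge points backward
contains a collider descending from its first vertex. -/
theorem exists_collider_between (hacyc : ∀ v, ¬ Relation.TransGen E v v) {f : ℕ → V} (d : ℕ) :
    ∀ i, (∀ k, i ≤ k → k ≤ i + d → E (f k) (f (k + 1)) ∨ E (f (k + 1)) (f k)) →
      E (f i) (f (i + 1)) → E (f (i + d + 1)) (f (i + d)) →
      ∃ k, i ≤ k ∧ k + 1 < i + d + 1 ∧ WalkCollides E f k ∧
        Relation.ReflTransGen E (f i) (f (k + 1)) := by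
  induction d with
  | zero =>
    intro i _ h1 h2
    exact absurd ((Relation.TransGen.single h1).tail h2) (hacyc _)
  | succ d ih =>
    intro i hadj h1 h2
    by_cases hc : E (f (i + 2)) (f (i + 1))
    · exact ⟨i, le_rfl, by omega, ⟨h1, hc⟩, .single h1⟩
    · have h3 := (hadj (i + 1) (by omega) (by omega)).resolve_right hc
      have e : i + 1 + d = i + (d + 1) := by omega
      obtain ⟨k, hk1, hk2, hk3, hk4⟩ := ih (i + 1)
        (fun k a b => hadj k (by omega) (by omega)) h3 (by rw [e]; exact h2)
      exact ⟨k, by omega, by omega, hk3, .head h1 hk4⟩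

theorem AncestorsOfSet.of_reflTransGen {S : Set V} {u v : V} (h : Relation.ReflTransGen E u v)
    (hv : v ∈ AncestorsOfSet E S) : u ∈ AncestorsOfSet E S := by
  obtain ⟨s, hs, hr⟩ := hv
  exact ⟨s, hs, h.trans hr⟩

/-- A closed segment can be cut out of an open walk. -/
theorem exists_shorter_walk (hacyc : ∀ v, ¬ Relation.TransGen E v v) {S : Set V} {X Y : V}
    {f : ℕ → V} {n : ℕ} (hf : IsWalk E X Y f n) (ho : WalkOpen E (AncestorsOfSet E S) S f n)
    {i j : ℕ} (hij : i < j) (hj : j ≤ n) (he : f i = f j) :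
    ∃ g m, m < n ∧ IsWalk E X Y g m ∧ WalkOpen E (AncestorsOfSet E S) S g m := by
  obtain ⟨d, rfl⟩ : ∃ d, j = i + d := ⟨j - i, by omega⟩
  obtain ⟨m, rfl⟩ : ∃ m, n = m + d := ⟨n - d, by omega⟩
  obtain ⟨g, hg1, hg2⟩ : ∃ g : ℕ → V, (∀ k ≤ i, g k = f k) ∧ ∀ k, i ≤ k → g k = f (k + d) := by
    refine ⟨fun k => if k ≤ i then f k else f (k + d), fun k hk => if_pos hk, fun k hk => ?_⟩
    by_cases h : k ≤ i
    · obtain rfl : k = i := le_antisymm h hk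
      simpa using he
    · exact if_neg h
  obtain ⟨h0, hn, hadj⟩ := hf
  refine ⟨g, m, by omega, ⟨?_, ?_, ?_⟩, ?_⟩
  · rw [hg1 0 (by omega), h0]
  · rw [hg2 m (by omega), hn]
  · intro k hk
    by_cases h : k + 1 ≤ i
    · rw [hg1 k (by omega), hg1 _ h]
      exact hadj k (by omega)
    · rw [hg2 k (by omega), hg2 (k + 1) (by omega), show k + 1 + d = k + d + 1 by omega]
      exact hadj (k + d) (by omega)
  · intro k hk
    rcases lt_trichotomy (k + 1) i with h | h | h
    · have := ho k (by omega)
      unfold WalkCollides at this ⊢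
      rwa [hg1 k (by omega), hg1 (k + 1) (by omega), hg1 (k + 2) (by omega)]
    · subst h
      have o1 := ho k (by omega)
      have o2 := ho (k + d) (by omega)
      have c := hg2 (k + 2) (by omega)
      unfold WalkCollides at o1 o2 ⊢
      rw [show k + d + 1 = k + 1 + d by omega, ← he,
        show k + d + 2 = k + 2 + d by omega] at o2
      rw [hg1 k (by omega), hg1 (k + 1) (by omega), c]
      constructor
      · rintro ⟨ha, hb⟩
        by_cases hc1 : E (f (k + 2)) (f (k + 1))
        · exact o1.1 ⟨ha, hc1⟩
        by_cases hc2 : E (f (k + d)) (f (k + 1))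
        · exact o2.1 ⟨hc2, hb⟩
        have e1 := (hadj (k + 1) (by omega)).resolve_right hc1
        have e2 := (hadj (k + d) (by omega)).resolve_left
          (by rw [show k + d + 1 = k + 1 + d by omega, ← he]; exact hc2)
        obtain ⟨d, rfl⟩ : ∃ d', d = d' + 1 := ⟨d - 1, by omega⟩
        obtain ⟨l, hl1, hl2, hl3, hl4⟩ := exists_collider_between hacyc d (k + 1)
          (fun l _ _ => hadj l (by omega)) e1
          (by rw [show k + 1 + d = k + (d + 1) by omega]; exact e2)
        exact AncestorsOfSet.of_reflTransGen hl4 ((ho l (by omega)).1 hl3)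
      · intro hc
        by_cases ha : E (f k) (f (k + 1))
        · exact o2.2 fun h => hc ⟨ha, h.2⟩
        · exact o1.2 fun h => ha h.1
    · have := ho (k + d) (by omega)
      unfold WalkCollides at this ⊢
      rwa [hg2 k (by omega), hg2 (k + 1) (by omega), hg2 (k + 2) (by omega),
        show k + 1 + d = k + d + 1 by omega, show k + 2 + d = k + d + 2 by omega]

theorem not_dsep_of_walkOpen (hacyc : ∀ v, ¬ Relation.TransGen E v v) {S : Set V} {X Y : V}
    (n : ℕ) : ∀ f, IsWalk E X Y f n → WalkOpen E (AncestorsOfSet E S) S f n →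
      ¬ DSep E X Y S := by
  induction n using Nat.strong_induction_on with
  | _ n ih =>
    intro f hf ho hd
    by_cases hinj : ∀ i j, i < j → j ≤ n → f i ≠ f j
    · refine (not_blocked_map_range_iff S f n).2 ho (hd _ (isPath_map_range hf hinj) ?_ ?_)
      · simp [List.head?_eq_getElem?, hf.1]
      · simp [List.getLast?_eq_getElem?, hf.2.1]
    · push Not at hinj
      obtain ⟨i, j, hij, hj, he⟩ := hinj
      obtain ⟨g, m, hm, hg, hgo⟩ := exists_shorter_walk hacyc hf ho hij hj he
      exact ih m hm g hg hgo hd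

theorem IsWalk.reverse {X Y : V} {f : ℕ → V} {n : ℕ} (hf : IsWalk E X Y f n) :
    IsWalk E Y X (fun k => f (n - k)) n := by
  refine ⟨by simpa using hf.2.1, by simpa using hf.1, fun k hk => ?_⟩
  have := hf.2.2 (n - (k + 1)) (by omega)
  rw [show n - (k + 1) + 1 = n - k by omega] at this
  exact this.symm

theorem WalkOpen.reverse {T S : Set V} {f : ℕ → V} {n : ℕ} (ho : WalkOpen E T S f n) :
    WalkOpen E T S (fun k => f (n - k)) n := by
  intro k hk
  have := ho (n - (k + 2)) (by omega)
  unfold WalkCollides at this ⊢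
  rw [show n - (k + 2) + 1 = n - (k + 1) by omega,
    show n - (k + 2) + 2 = n - k by omega, and_comm (a := E _ _)] at this
  exact this

/-- An open walk can be prolonged along a directed path leaving its start, provided that
the start is not an ancestor of the conditioning set. -/
theorem exists_walkOpen_extend_start (hacyc : ∀ v, ¬ Relation.TransGen E v v) {S : Set V}
    {u X Y : V} (hu : Relation.ReflTransGen E u X) (hS : u ∉ AncestorsOfSet E S)
    (h : ∃ f n, IsWalk E u Y f n ∧ WalkOpen E (AncestorsOfSet E S) S f n) :
    ∃ f n, IsWalk E X Y f n ∧ WalkOpen E (AncestorsOfSet E S) S f n := by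
  induction hu with
  | refl => exact h
  | @tail b c hub hbc ih =>
    obtain ⟨f, n, ⟨h0, hn, hadj⟩, ho⟩ := ih
    refine ⟨fun k => Nat.casesOn k c f, n + 1, ⟨rfl, hn, ?_⟩, ?_⟩
    · rintro (_ | k) hk
      · exact Or.inr (by simpa [h0] using hbc)
      · exact hadj k (by omega)
    · rintro (_ | k) hk
      · constructor
        · rintro ⟨h1, -⟩
          have h1 : E c (f 0) := h1
          rw [h0] at h1
          exact absurd ((Relation.TransGen.single hbc).tail h1) (hacyc _)
        · intro _ hb
          have hb : f 0 ∈ S := hb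
          rw [h0] at hb
          exact hS ⟨b, hb, hub⟩
      · exact ho k (by omega)

theorem exists_walkOpen_symm {T S : Set V} {X Y : V}
    (h : ∃ f n, IsWalk E X Y f n ∧ WalkOpen E T S f n) :
    ∃ f n, IsWalk E Y X f n ∧ WalkOpen E T S f n := by
  obtain ⟨f, n, hf, ho⟩ := h
  exact ⟨_, n, hf.reverse, ho.reverse⟩

theorem exists_walkOpen_extend (hacyc : ∀ v, ¬ Relation.TransGen E v v) {S : Set V}
    {u v X Y : V} (hu : u = X ∨ u ∈ Ancestors E X \ AncestorsOfSet E S)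
    (hv : v = Y ∨ v ∈ Ancestors E Y \ AncestorsOfSet E S)
    (h : ∃ f n, IsWalk E u v f n ∧ WalkOpen E (AncestorsOfSet E S) S f n) :
    ∃ f n, IsWalk E X Y f n ∧ WalkOpen E (AncestorsOfSet E S) S f n := by
  have hXv : ∃ f n, IsWalk E X v f n ∧ WalkOpen E (AncestorsOfSet E S) S f n := by
    rcases hu with rfl | ⟨hu, hS⟩
    · exact h
    · exact exists_walkOpen_extend_start hacyc hu hS h
  rcases hv with rfl | ⟨hv, hS⟩
  · exact hXv
  · exact exists_walkOpen_symm
      (exists_walkOpen_extend_start hacyc hv hS (exists_walkOpen_symm hXv))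

/-- An inducing walk yields an open walk for every conditioning set avoiding its
non-colliders. -/
theorem exists_walkOpen_of_inducing (hacyc : ∀ v, ¬ Relation.TransGen E v v) {S : Set V}
    {X Y : V} (n : ℕ) : ∀ (f : ℕ → V) (u v : V),
      (u = X ∨ u ∈ Ancestors E X \ AncestorsOfSet E S) →
      (v = Y ∨ v ∈ Ancestors E Y \ AncestorsOfSet E S) →
      IsWalk E u v f n → WalkOpen E (Ancestors E X ∪ Ancestors E Y) S f n →
      ∃ f n, IsWalk E X Y f n ∧ WalkOpen E (AncestorsOfSet E S) S f n := by
  induction n using Nat.strong_induction_on with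
  | _ n ih =>
    intro f u v hu hv hf ho
    by_cases hall : ∀ k, k + 1 < n → WalkCollides E f k → f (k + 1) ∈ AncestorsOfSet E S
    · exact exists_walkOpen_extend hacyc hu hv ⟨f, n, hf, fun k hk => ⟨hall k hk, (ho k hk).2⟩⟩
    · push Not at hall
      obtain ⟨k, hk, hc, hS⟩ := hall
      rcases (ho k hk).1 hc with hX | hY
      · obtain ⟨m, rfl⟩ : ∃ m, n = k + 1 + m := ⟨n - (k + 1), by omega⟩
        refine ih m (by omega) (fun l => f (k + 1 + l)) _ v (Or.inr ⟨hX, hS⟩) hv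
          ⟨rfl, hf.2.1, fun l hl => hf.2.2 (k + 1 + l) (by omega)⟩
          fun l hl => ho (k + 1 + l) (by omega)
      · exact ih (k + 1) hk f u _ hu (Or.inr ⟨hY, hS⟩)
          ⟨hf.1, rfl, fun l hl => hf.2.2 l (by omega)⟩ fun l hl => ho l (by omega)

/-- If the end of a walk and its colliders lie in an ancestrally closed set `T`, then so do
the tails of its forward edges. -/
theorem mem_of_forward_edge {T S : Set V} (hT : ∀ u v, E u v → v ∈ T → u ∈ T) {X Y : V}
    {f : ℕ → V} {n : ℕ} (hf : IsWalk E X Y f n) (ho : WalkOpen E T S f n) (hY : Y ∈ T)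
    {k : ℕ} (hk : k < n) (h : E (f k) (f (k + 1))) : f k ∈ T := by
  obtain ⟨d, rfl⟩ : ∃ d, n = k + 1 + d := ⟨n - (k + 1), by omega⟩
  refine hT _ _ h ?_
  induction d generalizing k with
  | zero => exact hf.2.1 ▸ hY
  | succ d ih =>
    by_cases hc : E (f (k + 2)) (f (k + 1))
    · exact (ho k (by omega)).1 ⟨h, hc⟩
    · have h3 := (hf.2.2 (k + 1) (by omega)).resolve_right hc
      have e : k + 1 + (d + 1) = k + 1 + 1 + d := by omega
      rw [e] at hf ho
      exact hT _ _ h3 (ih h3 hf ho (by omega))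

theorem mem_of_not_walkCollides {T S : Set V} (hT : ∀ u v, E u v → v ∈ T → u ∈ T) {X Y : V}
    {f : ℕ → V} {n : ℕ} (hf : IsWalk E X Y f n) (ho : WalkOpen E T S f n) (hX : X ∈ T)
    (hY : Y ∈ T) {k : ℕ} (hk : k + 1 < n) (hc : ¬ WalkCollides E f k) : f (k + 1) ∈ T := by
  by_cases h : E (f (k + 2)) (f (k + 1))
  · have h' := (hf.2.2 k (by omega)).resolve_left fun h' => hc ⟨h', h⟩
    have := mem_of_forward_edge hT hf.reverse ho.reverse hX (k := n - (k + 1)) (by omega)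
    simp only [show n - (n - (k + 1)) = k + 1 by omega,
      show n - (n - (k + 1) + 1) = k by omega] at this
    exact this h'
  · exact mem_of_forward_edge hT hf ho hY hk ((hf.2.2 (k + 1) hk).resolve_right h)

end

/-- In a DAG `H` with observed vertices `N` and distinct
observed vertices `X, Y ∈ N`, if some subset `S ⊆ N \ {X, Y}` d-separates `X`
and `Y`, then the specific set `(Anc_{{X,Y}} ∩ N) \ {X, Y}` d-separates them. -/
theorem dsep_by_observed_ancestors_of_dsep
    {V : Type} (E : V → V → Prop) (hacyc : ∀ v, ¬ Relation.TransGen E v v)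
    (N : Set V) (X Y : V) (hX : X ∈ N) (hY : Y ∈ N) (hXY : X ≠ Y)
    (hdsep : ∃ S ⊆ N \ {X, Y}, DSep E X Y S) :
    DSep E X Y (((Ancestors E X ∪ Ancestors E Y) ∩ N) \ {X, Y}) := by
  obtain ⟨S, hSN, hS⟩ := hdsep
  intro p hp hpX hpY
  by_contra hb
  obtain ⟨f, n, rfl, hf⟩ := exists_eq_map_range hp hpX hpY
  rw [not_blocked_map_range_iff] at hb
  have hT : ∀ u v, E u v → v ∈ Ancestors E X ∪ Ancestors E Y →
      u ∈ Ancestors E X ∪ Ancestors E Y := by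
    rintro u v huv (h | h)
    · exact Or.inl (.head huv h)
    · exact Or.inr (.head huv h)
  have ho : WalkOpen E (Ancestors E X ∪ Ancestors E Y)
      (((Ancestors E X ∪ Ancestors E Y) ∩ N) \ {X, Y}) f n := by
    refine fun k hk => ⟨fun hc => ?_, (hb k hk).2⟩
    obtain ⟨s, ⟨⟨hs | hs, -⟩, -⟩, hr⟩ := (hb k hk).1 hc
    · exact Or.inl (hr.trans hs)
    · exact Or.inr (hr.trans hs)
  have hind : WalkOpen E (Ancestors E X ∪ Ancestors E Y) S f n :=
    fun k hk => ⟨(ho k hk).1, fun hc hmem => (ho k hk).2 hc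
      ⟨⟨mem_of_not_walkCollides hT hf ho (Or.inl .refl) (Or.inr .refl) hk hc,
        (hSN hmem).1⟩, (hSN hmem).2⟩⟩
  obtain ⟨g, m, hg, hgo⟩ :=
    exists_walkOpen_of_inducing hacyc n f X Y (Or.inl rfl) (Or.inl rfl) hf hind
  exact not_dsep_of_walkOpen hacyc m g hg hgo hS
end
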